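/- Let Q be a square real matrix with nonnegative entries whose row sums are all at most 1, and suppose that for every index i there exists an integer r ≥ 1 such that the i-th row sum of Q^r is strictly less than 1. Then the Neumann series Σ_{i=0}^{∞} Q^i converges and equals (I − Q)^{−1}. -/

import Mathlib

section

attribute [local instance] Matrix.linftyOpNormedRing Matrix.linftyOpNormedAlgebra

/-- If some positive power of an element of a normed ring has norm less than one, then the
powers of that element tend to zero. -/
theorem tendsto_pow_nhds_zero_of_norm_pow_lt_one {R : Type*} [NormedRing R] {x : R} {N : ℕ}
    (hN : N ≠ 0) (hx : ‖x ^ N‖ < 1) :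
    Filter.Tendsto (fun r : ℕ => x ^ r) Filter.atTop (nhds 0) := by
  have hdiv : Filter.Tendsto (fun r : ℕ => (x ^ N) ^ (r / N)) Filter.atTop (nhds 0) :=
    (tendsto_pow_atTop_nhds_zero_of_norm_lt_one hx).comp
      (Nat.tendsto_div_const_atTop hN)
  have hbound : ∀ r, ‖x ^ r‖ ≤ ‖(x ^ N) ^ (r / N)‖ * ∑ k ∈ Finset.range N, ‖x ^ k‖ := by
    intro r
    calc ‖x ^ r‖ = ‖(x ^ N) ^ (r / N) * x ^ (r % N)‖ := by
          rw [← pow_mul, ← pow_add, Nat.div_add_mod]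
      _ ≤ ‖(x ^ N) ^ (r / N)‖ * ‖x ^ (r % N)‖ := norm_mul_le _ _
      _ ≤ _ := by
          gcongr
          exact Finset.single_le_sum (f := fun k => ‖x ^ k‖) (fun _ _ => norm_nonneg _)
            (Finset.mem_range.2 (Nat.mod_lt _ (Nat.pos_of_ne_zero hN)))
  refine squeeze_zero_norm hbound ?_
  simpa using hdiv.norm.mul_const (∑ k ∈ Finset.range N, ‖x ^ k‖)

/-- If some positive power of a square real matrix has `ℓ^∞` operator norm less than one, then
its Neumann series converges to `(1 - A)⁻¹`. -/
theorem Matrix.tendsto_sum_pow_of_norm_pow_lt_one {ι : Type*} [Fintype ι] [DecidableEq ι]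
    {A : Matrix ι ι ℝ} {N : ℕ} (hN : N ≠ 0) (hA : ‖A ^ N‖ < 1) :
    Filter.Tendsto (fun r : ℕ => ∑ i ∈ Finset.range r, A ^ i) Filter.atTop
      (nhds (1 - A)⁻¹) := by
  have hunit : IsUnit (1 - A).det := by
    have : CompleteSpace (Matrix ι ι ℝ) := FiniteDimensional.complete ℝ _
    have h := (Matrix.isUnit_iff_isUnit_det _).1 (isUnit_one_sub_of_norm_lt_one hA)
    rw [← mul_neg_geom_sum, Matrix.det_mul] at h
    exact isUnit_of_mul_isUnit_left h
  have hsum : ∀ r, ∑ i ∈ Finset.range r, A ^ i = (1 - A)⁻¹ * (1 - A ^ r) := by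
    intro r
    rw [← mul_neg_geom_sum, Matrix.nonsing_inv_mul_cancel_left _ _ hunit]
  simp_rw [hsum]
  have hlim :=
    ((tendsto_pow_nhds_zero_of_norm_pow_lt_one hN hA).const_sub 1).const_mul (1 - A)⁻¹
  rw [sub_zero, mul_one] at hlim
  exact hlim

/-- The `ℓ^∞` operator norm of a nonnegative matrix is less than one if all row sums are. -/
theorem Matrix.linftyOpNorm_lt_one_of_rowSum_lt_one {ι : Type*} [Fintype ι] [DecidableEq ι]
    {A : Matrix ι ι ℝ} (hnn : ∀ i j, 0 ≤ A i j) (hA : ∀ i, ∑ j, A i j < 1) : ‖A‖ < 1 := by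
  rw [Matrix.linfty_opNorm_def]
  norm_cast
  rw [Finset.sup_lt_iff (by simp)]
  intro i _
  rw [← NNReal.coe_lt_coe]
  simpa [abs_of_nonneg (hnn i _)] using hA i

end

/-- Powers of a nonnegative matrix are nonnegative. -/
theorem Matrix.pow_apply_nonneg_of_nonneg {ι : Type*} [Fintype ι] [DecidableEq ι]
    {A : Matrix ι ι ℝ} (hnn : ∀ i j, 0 ≤ A i j) (r : ℕ) (i j : ι) : 0 ≤ (A ^ r) i j := by
  induction r generalizing i j with
  | zero => rw [pow_zero, Matrix.one_apply]; positivity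
  | succ r ih =>
    rw [pow_succ, Matrix.mul_apply]
    exact Finset.sum_nonneg fun k _ => mul_nonneg (ih i k) (hnn k j)

/-- The row sums of the powers of a substochastic matrix decrease with the exponent. -/
theorem Matrix.antitone_rowSum_pow {ι : Type*} [Fintype ι] [DecidableEq ι]
    {A : Matrix ι ι ℝ} (hnn : ∀ i j, 0 ≤ A i j) (hrow : ∀ i, ∑ j, A i j ≤ 1) (i : ι) :
    Antitone fun r : ℕ => ∑ j, (A ^ r) i j := by
  refine antitone_nat_of_succ_le fun r => ?_
  simp_rw [pow_succ, Matrix.mul_apply]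
  rw [Finset.sum_comm]
  refine Finset.sum_le_sum fun k _ => ?_
  rw [← Finset.mul_sum]
  exact mul_le_of_le_one_right (Matrix.pow_apply_nonneg_of_nonneg hnn r i k) (hrow k)

/-- If `Q` is entrywise nonnegative with all row sums at most 1, and for every index `i`
some power `Q^r` (with `r ≥ 1`) has `i`-th row sum strictly less than 1, then the Neumann
series `∑ Q^i` converges to `(I - Q)⁻¹`. -/
theorem substochastic_neumann_series (n : ℕ) (Q : Matrix (Fin n) (Fin n) ℝ)
    (hnn : ∀ i j, 0 ≤ Q i j) (hrow : ∀ i, ∑ j, Q i j ≤ 1)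
    (h : ∀ i : Fin n, ∃ r : ℕ, 1 ≤ r ∧ ∑ j, (Q ^ r) i j < 1) :
    Filter.Tendsto (fun r : ℕ => ∑ i ∈ Finset.range r, Q ^ i) Filter.atTop
      (nhds (1 - Q)⁻¹) := by
  choose r _ hr using h
  refine Matrix.tendsto_sum_pow_of_norm_pow_lt_one (N := Finset.univ.sup r + 1)
    (Nat.succ_ne_zero _) ?_
  refine Matrix.linftyOpNorm_lt_one_of_rowSum_lt_one
    (Matrix.pow_apply_nonneg_of_nonneg hnn _) fun i => ?_
  exact (Matrix.antitone_rowSum_pow hnn hrow i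
    (Nat.le_succ_of_le (Finset.le_sup (Finset.mem_univ i)))).trans_lt (hr i)
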